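/- Let W_n be the number of white balls at time n in a large-index urn (model M or model R) with 1/2 < Λ < 1, and let 𝒲_∞ be the almost sure limit of the martingale 𝒲_n := g_n(W_n − E[W_n]). Then the distribution of 𝒲_∞ is absolutely continuous with respect to Lebesgue measure on (−∞,∞) and admits a bounded density. -/

import Mathlib

open MeasureTheory ProbabilityTheory Filter Set Topology

noncomputable section

/-- Probability of drawing `k` white balls in a sample of size `m` from an urn with
`w` white and `b` black balls, drawing *without* replacement (model M). -/
def sampleProbM (m k w b : ℕ) : ℝ :=
  (Nat.choose w k * Nat.choose b (m - k) : ℝ) / (Nat.choose (w + b) m : ℝ)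

/-- Probability of drawing `k` white balls in a sample of size `m` from an urn with
`w` white and `b` black balls, drawing *with* replacement (model R). -/
def sampleProbR (m k w b : ℕ) : ℝ :=
  (Nat.choose m k : ℝ) * (w : ℝ) ^ k * (b : ℝ) ^ (m - k) / ((w : ℝ) + (b : ℝ)) ^ m

/-- A balanced affine tenable two-color urn scheme with multiple drawings.
`mdlM = true` is model M (sampling without replacement), `mdlM = false` is model R
(sampling with replacement).  `W n`, `B n` are the numbers of white and black balls
after `n` draws (ℕ-valued, which encodes tenability), `R (n+1)` is the number of white
balls in the `(n+1)`-st sample, and `F` is the filtration generated by the draws. -/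
structure UrnScheme {Ω : Type*} [m0 : MeasurableSpace Ω] (μ : Measure Ω)
    (mdlM : Bool) (m : ℕ) (a b : ℕ → ℤ) (σ : ℤ) (W0 B0 : ℕ)
    (W B : ℕ → Ω → ℕ) (R : ℕ → Ω → ℕ) (F : Filtration ℕ m0) : Prop where
  hm : 1 ≤ m
  hσ : 1 ≤ σ
  balanced : ∀ k ≤ m, a k + b k = σ
  affine : ∀ k ≤ m, a k = ((m : ℤ) - (k : ℤ)) * (a (m - 1) - a m) + a m
  initW : ∀ ω, W 0 ω = W0
  initB : ∀ ω, B 0 ω = B0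
  sampleLe : ∀ n ω, R (n + 1) ω ≤ m
  sampleFit : ∀ n ω, (if mdlM then m else 1) ≤ W n ω + B n ω
  dynW : ∀ n ω, (W (n + 1) ω : ℤ) = (W n ω : ℤ) + a (m - R (n + 1) ω)
  dynB : ∀ n ω, (B (n + 1) ω : ℤ) = (B n ω : ℤ) + b (m - R (n + 1) ω)
  measW : ∀ n, Measurable[F n] (W n)
  measB : ∀ n, Measurable[F n] (B n)
  measR : ∀ n, Measurable[F (n + 1)] (R (n + 1))
  condLaw : ∀ n, ∀ k ≤ m,
      (μ[(({ω | R (n + 1) ω = k}).indicator fun _ => (1 : ℝ)) | F n])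
        =ᵐ[μ] fun ω =>
          if mdlM then sampleProbM m k (W n ω) (B n ω)
          else sampleProbR m k (W n ω) (B n ω)

/-- The urn index `Λ = m (a_{m-1} - a_m) / σ`. -/
def urnIndex (m : ℕ) (a : ℕ → ℤ) (σ : ℤ) : ℝ :=
  (m : ℝ) * ((a (m - 1) : ℝ) - (a m : ℝ)) / (σ : ℝ)

/-- `ζ = a_m / (1 - Λ)`. -/
def urnZeta (m : ℕ) (a : ℕ → ℤ) (σ : ℤ) : ℝ :=
  (a m : ℝ) / (1 - urnIndex m a σ)

/-- `Q = Γ(T₀/σ + Λ) / Γ(T₀/σ)`. -/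
def urnQ (T0 : ℕ) (σ : ℤ) (Λ : ℝ) : ℝ :=
  Real.Gamma ((T0 : ℝ) / (σ : ℝ) + Λ) / Real.Gamma ((T0 : ℝ) / (σ : ℝ))

/-- `g_n = Q · Γ(n + T₀/σ) / Γ(n + T₀/σ + Λ)`. -/
def urnG (T0 : ℕ) (σ : ℤ) (Λ : ℝ) (n : ℕ) : ℝ :=
  urnQ T0 σ Λ * Real.Gamma ((n : ℝ) + (T0 : ℝ) / (σ : ℝ)) /
    Real.Gamma ((n : ℝ) + (T0 : ℝ) / (σ : ℝ) + Λ)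

/-- Convergence in distribution of the sequence `X n` (on `(Ω, μ)`) to the law `ν`,
i.e. weak convergence of the image measures. -/
def TendstoInDistribution {Ω : Type*} [MeasurableSpace Ω] (μ : Measure Ω)
    (X : ℕ → Ω → ℝ) (ν : Measure ℝ) : Prop :=
  ∀ f : BoundedContinuousFunction ℝ ℝ,
    Tendsto (fun n => ∫ ω, f (X n ω) ∂μ) atTop (𝓝 (∫ x, f x ∂ν))

/-- The martingale `𝒲_n = g_n (W_n - E[W_n])` for large-index urns. -/
def calW {Ω : Type*} [MeasurableSpace Ω] (μ : Measure Ω) (σ : ℤ) (Λ : ℝ) (T0 : ℕ)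
    (W : ℕ → Ω → ℕ) (n : ℕ) (ω : Ω) : ℝ :=
  urnG T0 σ Λ n * ((W n ω : ℝ) - ∫ ω', (W n ω' : ℝ) ∂μ)

/-- The scaling constant `α = ((1-Λ)/(QΛ)) √(m(2Λ-1)/(a_m b_0))`. -/
def alphaConst (m : ℕ) (a b : ℕ → ℤ) (σ : ℤ) (T0 : ℕ) : ℝ :=
  (1 - urnIndex m a σ) / (urnQ T0 σ (urnIndex m a σ) * urnIndex m a σ) *
    Real.sqrt ((m : ℝ) * (2 * urnIndex m a σ - 1) / ((a m : ℝ) * (b 0 : ℝ)))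

theorem Measure.le_smul_volume_of_closedBall_le (ν : Measure ℝ) [IsFiniteMeasure ν] (C : NNReal)
    (h : ∀ x r : ℝ, 0 < r → ν (Metric.closedBall x r) ≤ C * volume (Metric.closedBall x r)) :
    ν ≤ C • (volume : Measure ℝ) := by
  refine Measure.le_intro fun s _ _ => ?_
  refine (Besicovitch.vitaliFamily ν).measure_le_of_frequently_le (C • (volume : Measure ℝ))
    Measure.AbsolutelyContinuous.rfl s fun x _ => ?_
  refine (Besicovitch.tendsto_filterAt ν x).frequently (Eventually.frequently ?_)
  filter_upwards [self_mem_nhdsWithin] with r hr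
  exact h x r hr

theorem Measure.exists_bounded_density_of_le_smul_volume (ν : Measure ℝ) [IsFiniteMeasure ν]
    (C : NNReal) (h : ν ≤ C • (volume : Measure ℝ)) :
    ν ≪ volume ∧ ∃ f : ℝ → ℝ, (∀ x, 0 ≤ f x) ∧ (∃ K : ℝ, ∀ x, f x ≤ K) ∧
      ν = volume.withDensity fun x => ENNReal.ofReal (f x) := by
  have hac : ν ≪ volume := (Measure.absolutelyContinuous_of_le h).trans
    (Measure.smul_absolutelyContinuous)
  refine ⟨hac, fun x => min (ν.rnDeriv volume x).toReal C,
    fun x => le_min ENNReal.toReal_nonneg C.2, ⟨C, fun x => min_le_right _ _⟩, ?_⟩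
  have hle : ν.rnDeriv volume ≤ᵐ[volume] fun _ => (C : ENNReal) := by
    refine ae_le_of_forall_setLIntegral_le_of_sigmaFinite (Measure.measurable_rnDeriv _ _)
      fun s _ _ => ?_
    calc ∫⁻ x in s, ν.rnDeriv volume x ≤ ν s := Measure.setLIntegral_rnDeriv_le s
      _ ≤ (C • (volume : Measure ℝ)) s := h s
      _ = ∫⁻ _ in s, (C : ENNReal) := (setLIntegral_const s _).symm
  rw [← Measure.withDensity_rnDeriv_eq ν volume hac]
  refine withDensity_congr_ae ?_
  have hac' := Measure.withDensity_rnDeriv_eq ν volume hac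
  rw [hac']
  filter_upwards [hle] with x hx
  rw [min_eq_left, ENNReal.ofReal_toReal (ne_top_of_le_ne_top ENNReal.coe_ne_top hx)]
  simpa using ENNReal.toReal_mono ENNReal.coe_ne_top hx

theorem measure_preimage_Ioo_le_of_tendsto_ae {Ω : Type*} [MeasurableSpace Ω] (μ : Measure Ω)
    {X : ℕ → Ω → ℝ} {Y : Ω → ℝ} (hX : ∀ n, Measurable (X n))
    (hlim : ∀ᵐ ω ∂μ, Tendsto (fun n => X n ω) atTop (𝓝 (Y ω))) {x y c : ℝ} {d : ℕ → ℝ}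
    (hbd : ∀ᶠ n in atTop, μ (X n ⁻¹' Ioo x y) ≤ ENNReal.ofReal (d n))
    (hd : Tendsto d atTop (𝓝 c)) :
    μ (Y ⁻¹' Ioo x y) ≤ ENNReal.ofReal c := by
  have hm : ∀ n, MeasurableSet (X n ⁻¹' Ioo x y) := fun n => hX n measurableSet_Ioo
  calc μ (Y ⁻¹' Ioo x y)
      ≤ μ {ω | 1 ≤ liminf (fun n => (X n ⁻¹' Ioo x y).indicator (1 : Ω → ENNReal) ω) atTop} := by
        refine measure_mono_ae ?_
        filter_upwards [hlim] with ω hω hmem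
        refine le_liminf_of_le (by isBoundedDefault) ?_
        filter_upwards [hω.eventually (isOpen_Ioo.mem_nhds hmem)] with n hn
        rw [indicator_of_mem (show ω ∈ X n ⁻¹' Ioo x y from hn)]
        simp
    _ ≤ ∫⁻ ω, liminf (fun n => (X n ⁻¹' Ioo x y).indicator (1 : Ω → ENNReal) ω) atTop ∂μ := by
        simpa using mul_meas_ge_le_lintegral
          (Measurable.liminf fun n => measurable_one.indicator (hm n)) (μ := μ) 1
    _ ≤ liminf (fun n => ∫⁻ ω, (X n ⁻¹' Ioo x y).indicator (1 : Ω → ENNReal) ω ∂μ) atTop :=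
        lintegral_liminf_le fun n => measurable_one.indicator (hm n)
    _ = liminf (fun n => μ (X n ⁻¹' Ioo x y)) atTop := by
        simp_rw [lintegral_indicator_one (hm _)]
    _ ≤ liminf (fun n => ENNReal.ofReal (d n)) atTop := liminf_le_liminf hbd
    _ = ENNReal.ofReal c := (ENNReal.tendsto_ofReal hd).liminf_eq

theorem sum_neg_one_pow_mul_choose_mul_eval_sub (p : Polynomial ℝ) (hp : p.Monic) (x h : ℝ)
    (hh : h ≠ 0) :
    ∑ k ∈ Finset.range (p.natDegree + 1),
      (-1 : ℝ) ^ (p.natDegree + k) * (p.natDegree.choose k) * p.eval (x - h * k) =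
      (-h) ^ p.natDegree * p.natDegree.factorial := by
  set q : Polynomial ℝ := Polynomial.C (-h) * Polynomial.X + Polynomial.C x with hq
  have hqd : q.natDegree = 1 := Polynomial.natDegree_linear (neg_ne_zero.2 hh)
  have hql : q.leadingCoeff = -h := Polynomial.leadingCoeff_linear (neg_ne_zero.2 hh)
  have hd : (p.comp q).natDegree = p.natDegree := by rw [Polynomial.natDegree_comp, hqd, mul_one]
  have hl : (p.comp q).leadingCoeff = (-h) ^ p.natDegree := by
    rw [Polynomial.leadingCoeff_comp (by rw [hqd]; exact one_ne_zero), hql, hp.leadingCoeff,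
      one_mul]
  have key := congrFun (Polynomial.fwdDiff_iter_degree_eq_factorial (p.comp q)) 0
  rw [hd, hl, fwdDiff_iter_eq_sum_shift] at key
  simp only [Pi.smul_apply, Pi.natCast_apply, smul_eq_mul] at key
  rw [← key]
  refine Finset.sum_congr rfl fun k hk => ?_
  have hk' : k ≤ p.natDegree := Nat.lt_succ_iff.1 (Finset.mem_range.1 hk)
  have hs : (-1 : ℝ) ^ (p.natDegree + k) = (-1) ^ (p.natDegree - k) := by
    rw [show p.natDegree + k = (p.natDegree - k) + 2 * k by omega, pow_add, pow_mul]; simp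
  rw [hs, zsmul_eq_mul, Polynomial.eval_comp]
  push_cast
  congr 2
  simp [hq]
  ring

/-- Alternating Vandermonde-type convolution. -/
theorem sum_neg_one_pow_mul_choose_mul_choose (p b l : ℕ) :
    ∑ i ∈ Finset.range (l + 1), (-1 : ℤ) ^ i * p.choose i * ((p + b - i).choose (l - i) : ℤ) =
      b.choose l := by
  induction p generalizing b l with
  | zero =>
    rw [Finset.sum_range_succ']
    simp
  | succ p ih =>
    rw [Finset.sum_range_succ']
    cases l with
    | zero => simp
    | succ l =>
      have h1 := ih (b + 1) (l + 1)
      have h2 := ih b l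
      rw [Finset.sum_range_succ'] at h1
      have h3 : ((b + 1).choose (l + 1) : ℤ) = b.choose l + b.choose (l + 1) := by
        exact_mod_cast Nat.choose_succ_succ b l
      have h4 : ∑ k ∈ Finset.range (l + 1), (-1 : ℤ) ^ (k + 1) * ((p + 1).choose (k + 1) : ℤ) *
          ((p + 1 + b - (k + 1)).choose (l + 1 - (k + 1)) : ℤ) =
          ∑ k ∈ Finset.range (l + 1), (-1 : ℤ) ^ (k + 1) * (p.choose (k + 1) : ℤ) *
          ((p + (b + 1) - (k + 1)).choose (l + 1 - (k + 1)) : ℤ) -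
          ∑ i ∈ Finset.range (l + 1), (-1 : ℤ) ^ i * p.choose i *
            ((p + b - i).choose (l - i) : ℤ) := by
        rw [← Finset.sum_sub_distrib]
        refine Finset.sum_congr rfl fun k _ => ?_
        rw [Nat.choose_succ_succ, show p + 1 + b - (k + 1) = p + b - k by omega,
          show p + (b + 1) - (k + 1) = p + b - k by omega, show l + 1 - (k + 1) = l - k by omega]
        push_cast
        ring
      rw [h4, h2]
      rw [h3] at h1
      simp only [Nat.choose_zero_right, pow_zero, Nat.sub_zero] at h1 ⊢
      rw [show p + 1 + b = p + (b + 1) by omega]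
      linarith

/-- The monic polynomial whose ratio of values gives the factorial moments of a sample. -/
def momentPoly (mdlM : Bool) (n : ℕ) : Polynomial ℝ :=
  if mdlM then descPochhammer ℝ n else Polynomial.X ^ n

theorem momentPoly_monic (mdlM : Bool) (n : ℕ) : (momentPoly mdlM n).Monic := by
  unfold momentPoly
  split_ifs
  · exact monic_descPochhammer ℝ n
  · exact Polynomial.monic_X_pow n

theorem momentPoly_natDegree (mdlM : Bool) (n : ℕ) : (momentPoly mdlM n).natDegree = n := by
  unfold momentPoly
  split_ifs
  · exact descPochhammer_natDegree ℝ n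
  · exact Polynomial.natDegree_X_pow n

/-- Inclusion-exclusion expression of the probability of `k` white balls in a sample. -/
def samplePoly (mdlM : Bool) (m k : ℕ) (T z : ℝ) : ℝ :=
  ∑ n ∈ Finset.range (m + 1), (-1 : ℝ) ^ (n + k) * n.choose k * m.choose n *
    ((momentPoly mdlM n).eval z / (momentPoly mdlM n).eval T)

theorem samplePoly_eq_sum_shift (mdlM : Bool) {m k : ℕ} (hk : k ≤ m) (T z : ℝ) :
    samplePoly mdlM m k T z = ∑ i ∈ Finset.range (m - k + 1), (-1 : ℝ) ^ i *
      (k + i).choose k * m.choose (k + i) *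
      ((momentPoly mdlM (k + i)).eval z / (momentPoly mdlM (k + i)).eval T) := by
  unfold samplePoly
  rw [show m + 1 = k + (m - k + 1) by omega, Finset.sum_range_add, Finset.sum_eq_zero, zero_add]
  · refine Finset.sum_congr rfl fun i _ => ?_
    rw [show k + i + k = i + 2 * k by ring, pow_add, pow_mul]
    simp
  · intro n hn
    rw [Nat.choose_eq_zero_of_lt (Finset.mem_range.1 hn)]
    simp

theorem sampleProbR_eq_samplePoly {m k w b : ℕ} (hk : k ≤ m) (hT : 1 ≤ w + b) :
    sampleProbR m k w b = samplePoly false m k ((w : ℝ) + b) w := by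
  have hT0 : (w : ℝ) + b ≠ 0 := by
    have : (1 : ℝ) ≤ w + b := by exact_mod_cast hT
    positivity
  rw [samplePoly_eq_sum_shift false hk]
  simp only [momentPoly, Bool.false_eq_true, if_false, Polynomial.eval_pow, Polynomial.eval_X]
  have hb : (b : ℝ) / (w + b) = -(w / (w + b)) + 1 := by field_simp; ring
  have h1 : sampleProbR m k w b =
      m.choose k * (w / (w + b) : ℝ) ^ k * (b / (w + b) : ℝ) ^ (m - k) := by
    unfold sampleProbR
    rw [div_pow, div_pow]
    conv_lhs => rw [show m = k + (m - k) by omega]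
    rw [pow_add, show k + (m - k) = m by omega]
    field_simp
  rw [h1, hb, add_pow, Finset.mul_sum]
  refine Finset.sum_congr rfl fun i hi => ?_
  have h2 := Nat.choose_mul (n := m) (k := k + i) (s := k)
    (by omega)
  rw [show k + i - k = i by omega] at h2
  have h3 : ((m.choose (k + i) : ℝ)) * (k + i).choose k = m.choose k * (m - k).choose i := by
    exact_mod_cast h2
  rw [← div_pow, pow_add, neg_pow, one_pow]
  linear_combination (-(-1 : ℝ) ^ i * (w / (w + b) : ℝ) ^ k * (w / (w + b) : ℝ) ^ i) * h3

theorem sampleProbM_eq_samplePoly {m k w b : ℕ} (hk : k ≤ m) (hT : m ≤ w + b) :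
    sampleProbM m k w b = samplePoly true m k ((w : ℝ) + b) w := by
  have hc : ((w + b).choose m : ℝ) ≠ 0 := by
    exact_mod_cast (Nat.choose_pos hT).ne'
  rw [samplePoly_eq_sum_shift true hk]
  simp only [momentPoly, if_true]
  unfold sampleProbM
  rw [div_eq_iff hc, Finset.sum_mul]
  have hterm : ∀ i ∈ Finset.range (m - k + 1), (-1 : ℝ) ^ i * (k + i).choose k *
      m.choose (k + i) * ((descPochhammer ℝ (k + i)).eval (w : ℝ) /
        (descPochhammer ℝ (k + i)).eval ((w : ℝ) + b)) * ((w + b).choose m : ℝ) =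
      w.choose k * ((-1 : ℝ) ^ i * (w - k).choose i * ((w + b - (k + i)).choose (m - k - i))) := by
    intro i hi
    have hi' : k + i ≤ m := by have := Finset.mem_range.1 hi; omega
    rw [← Nat.cast_add w b, descPochhammer_eval_eq_descFactorial,
      descPochhammer_eval_eq_descFactorial, Nat.descFactorial_eq_factorial_mul_choose,
      Nat.descFactorial_eq_factorial_mul_choose]
    have hf : ((k + i).factorial : ℝ) ≠ 0 := by exact_mod_cast (Nat.factorial_pos _).ne'
    have hc2 : ((w + b).choose (k + i) : ℝ) ≠ 0 := by
      exact_mod_cast (Nat.choose_pos (hi'.trans hT)).ne'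
    have h1 : ((w + b).choose m : ℝ) * m.choose (k + i) =
        (w + b).choose (k + i) * (w + b - (k + i)).choose (m - k - i) := by
      rw [Nat.sub_sub]
      exact_mod_cast Nat.choose_mul hi'
    have h2 : (w.choose (k + i) : ℝ) * (k + i).choose k = w.choose k * (w - k).choose i := by
      have := Nat.choose_mul (n := w) (Nat.le_add_right k i)
      rw [show k + i - k = i by omega] at this
      exact_mod_cast this
    push_cast
    rw [mul_div_mul_left _ _ hf]
    field_simp
    linear_combination ((k + i).choose k * w.choose (k + i) : ℝ) * h1 +
      ((w + b).choose (k + i) * (w + b - (k + i)).choose (m - k - i) : ℝ) * h2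
  rw [Finset.sum_congr rfl hterm, ← Finset.mul_sum]
  rcases le_or_gt k w with h | h
  · congr 1
    have h3 := sum_neg_one_pow_mul_choose_mul_choose (w - k) b (m - k)
    rw [← Int.cast_natCast (R := ℝ), ← h3]
    push_cast
    refine Finset.sum_congr rfl fun i _ => ?_
    rw [show w + b - (k + i) = w - k + b - i by omega]
  · rw [Nat.choose_eq_zero_of_lt h]; simp

theorem sum_samplePoly (mdlM : Bool) (m : ℕ) (T x h : ℝ) (hh : h ≠ 0) :
    ∑ k ∈ Finset.range (m + 1), samplePoly mdlM m k T (x - h * k) =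
      ∑ n ∈ Finset.range (m + 1), m.choose n * n.factorial * (-h) ^ n /
        (momentPoly mdlM n).eval T := by
  unfold samplePoly
  rw [Finset.sum_comm]
  refine Finset.sum_congr rfl fun n hn => ?_
  have hn' : n ≤ m := Nat.lt_succ_iff.1 (Finset.mem_range.1 hn)
  have key := sum_neg_one_pow_mul_choose_mul_eval_sub (momentPoly mdlM n)
    (momentPoly_monic mdlM n) x h hh
  rw [momentPoly_natDegree] at key
  have h1 : (m.choose n * n.factorial * (-h) ^ n : ℝ) / (momentPoly mdlM n).eval T =
      (m.choose n / (momentPoly mdlM n).eval T) * ((-h) ^ n * n.factorial) := by ring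
  rw [h1, ← key, Finset.mul_sum]
  symm
  have hsub : Finset.range (n + 1) ⊆ Finset.range (m + 1) := by
    intro k hk; rw [Finset.mem_range] at *; omega
  rw [← Finset.sum_subset hsub]
  · refine Finset.sum_congr rfl fun k _ => ?_
    ring
  · intro k _ hk
    rw [Nat.choose_eq_zero_of_lt (by rw [Finset.mem_range] at hk; omega)]
    simp

theorem momentPoly_eval_ge (mdlM : Bool) {n m : ℕ} (hn : n ≤ m) {T : ℝ} (hT : 2 * m ≤ T) :
    (T / 2) ^ n ≤ (momentPoly mdlM n).eval T := by
  have hT0 : 0 ≤ T := le_trans (by positivity) hT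
  have hnm : (n : ℝ) ≤ m := by exact_mod_cast hn
  unfold momentPoly
  split_ifs
  · refine le_trans ?_ (pow_le_descPochhammer_eval (by linarith))
    exact pow_le_pow_left₀ (by positivity) (by linarith) n
  · simpa using pow_le_pow_left₀ (by positivity) (by linarith) n

theorem exists_sum_samplePoly_le (mdlM : Bool) (m : ℕ) (hm : 1 ≤ m) (h : ℝ) (hh : 0 < h) :
    ∃ K : ℝ, 0 ≤ K ∧ ∀ T x : ℝ, 2 * m ≤ T →
      ∑ k ∈ Finset.range (m + 1), samplePoly mdlM m k T (x - h * k) ≤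
        1 - m * h / T + K / T ^ 2 := by
  refine ⟨∑ n ∈ Finset.range (m - 1), m.choose (n + 2) * (n + 2).factorial * h ^ (n + 2) *
    2 ^ (n + 2), by positivity, fun T x hT => ?_⟩
  have hm' : (1 : ℝ) ≤ m := by exact_mod_cast hm
  have hT1 : 1 ≤ T := by linarith
  rw [sum_samplePoly mdlM m T x h hh.ne', show m + 1 = (m - 1) + 1 + 1 by omega,
    Finset.sum_range_succ', Finset.sum_range_succ', Finset.sum_div]
  have h0 : (momentPoly mdlM 0).eval T = 1 := by unfold momentPoly; split_ifs <;> simp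
  have h1 : (momentPoly mdlM (0 + 1)).eval T = T := by unfold momentPoly; split_ifs <;> simp
  have hle : ∀ n ∈ Finset.range (m - 1),
      (m.choose (n + 1 + 1) * (n + 1 + 1).factorial * (-h) ^ (n + 1 + 1) : ℝ) /
        (momentPoly mdlM (n + 1 + 1)).eval T ≤
      m.choose (n + 2) * (n + 2).factorial * h ^ (n + 2) * 2 ^ (n + 2) / T ^ 2 := by
    intro n hn
    have hn' : n + 2 ≤ m := by have := Finset.mem_range.1 hn; omega
    have hge := momentPoly_eval_ge mdlM hn' hT
    have hge2 : T ^ 2 / 2 ^ (n + 2) ≤ (momentPoly mdlM (n + 2)).eval T := by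
      refine le_trans ?_ hge
      rw [div_pow]
      gcongr
      omega
    have hpos : 0 < T ^ 2 / 2 ^ (n + 2) := by positivity
    calc _ ≤ (m.choose (n + 2) * (n + 2).factorial * h ^ (n + 2) : ℝ) /
        (momentPoly mdlM (n + 2)).eval T := by
          have : (-h) ^ (n + 2) ≤ h ^ (n + 2) := by
            refine (le_abs_self _).trans ?_
            rw [abs_pow, abs_neg, abs_of_pos hh]
          have := hpos.trans_le hge2
          gcongr
      _ ≤ (m.choose (n + 2) * (n + 2).factorial * h ^ (n + 2) : ℝ) / (T ^ 2 / 2 ^ (n + 2)) := by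
          gcongr
      _ = _ := by field_simp
  have := Finset.sum_le_sum hle
  rw [h0, h1]
  simp only [zero_add, Nat.choose_one_right, Nat.choose_zero_right, Nat.factorial_one,
    Nat.factorial_zero, Nat.cast_one, pow_one, pow_zero, mul_one, div_one]
  have h2 : (m : ℝ) * -h / T = -(m * h / T) := by ring
  rw [h2]
  linarith

theorem samplePoly_nonneg {mdlM : Bool} {m k w b : ℕ} (hk : k ≤ m)
    (hT : (if mdlM then m else 1) ≤ w + b) :
    0 ≤ samplePoly mdlM m k ((w : ℝ) + b) w := by
  cases mdlM
  · rw [← sampleProbR_eq_samplePoly hk (by simpa using hT)]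
    unfold sampleProbR
    positivity
  · rw [← sampleProbM_eq_samplePoly hk (by simpa using hT)]
    unfold sampleProbM
    positivity

theorem urnG_pos {T0 : ℕ} {σ : ℤ} {Λ : ℝ} (hT0 : 1 ≤ T0) (hσ : 1 ≤ σ) (hΛ : 0 < Λ) (n : ℕ) :
    0 < urnG T0 σ Λ n := by
  have hτ : (0 : ℝ) < T0 / σ := div_pos (by exact_mod_cast hT0) (by exact_mod_cast hσ)
  unfold urnG urnQ
  have h1 := Real.Gamma_pos_of_pos hτ
  have h2 := Real.Gamma_pos_of_pos (show (0 : ℝ) < T0 / σ + Λ by positivity)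
  have h3 := Real.Gamma_pos_of_pos (show (0 : ℝ) < n + T0 / σ by positivity)
  have h4 := Real.Gamma_pos_of_pos (show (0 : ℝ) < n + T0 / σ + Λ by positivity)
  positivity

theorem urnG_succ {T0 : ℕ} {σ : ℤ} {Λ : ℝ} (hT0 : 1 ≤ T0) (hσ : 1 ≤ σ) (hΛ : 0 < Λ) (n : ℕ) :
    urnG T0 σ Λ (n + 1) =
      urnG T0 σ Λ n * (((n : ℝ) + T0 / σ) / ((n : ℝ) + T0 / σ + Λ)) := by
  have hτ : (0 : ℝ) < T0 / σ := div_pos (by exact_mod_cast hT0) (by exact_mod_cast hσ)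
  unfold urnG
  have h3 : ((n + 1 : ℕ) : ℝ) + T0 / σ = ((n : ℝ) + T0 / σ) + 1 := by push_cast; ring
  have h4 : ((n + 1 : ℕ) : ℝ) + T0 / σ + Λ = ((n : ℝ) + T0 / σ + Λ) + 1 := by push_cast; ring
  rw [h4, h3, Real.Gamma_add_one (by positivity), Real.Gamma_add_one (by positivity)]
  set G := Real.Gamma ((n : ℝ) + T0 / σ + Λ)
  set N := (n : ℝ) + T0 / σ
  rw [mul_comm (N + Λ) G, ← div_div]
  ring

theorem tendsto_urnG_zero {T0 : ℕ} {σ : ℤ} {Λ : ℝ} (hT0 : 1 ≤ T0) (hσ : 1 ≤ σ)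
    (hΛ : 1 / 2 < Λ) : Tendsto (urnG T0 σ Λ) atTop (𝓝 0) := by
  have hΛ0 : 0 < Λ := by linarith
  have hτ : (0 : ℝ) < T0 / σ := div_pos (by exact_mod_cast hT0) (by exact_mod_cast hσ)
  have hanti : Antitone fun n : ℕ => urnG T0 σ Λ n ^ 2 * ((n : ℝ) + T0 / σ) := by
    refine antitone_nat_of_succ_le fun n => ?_
    rw [urnG_succ hT0 hσ hΛ0]
    set N : ℝ := (n : ℝ) + T0 / σ with hN
    have hN0 : 0 < N := by positivity
    have h3 : ((n + 1 : ℕ) : ℝ) + T0 / σ = N + 1 := by rw [hN]; push_cast; ring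
    rw [h3, mul_pow, mul_assoc]
    refine mul_le_mul_of_nonneg_left ?_ (sq_nonneg _)
    rw [div_pow, div_mul_eq_mul_div, div_le_iff₀ (by positivity)]
    nlinarith [mul_pos hN0 hN0, mul_pos hN0 hΛ0, mul_pos (mul_pos hN0 hN0) (sub_pos.2 hΛ),
      mul_pos hN0 (mul_pos hΛ0 hΛ0)]
  have hsq : Tendsto (fun n => urnG T0 σ Λ n ^ 2) atTop (𝓝 0) := by
    refine squeeze_zero (fun n => sq_nonneg _)
      (g := fun n : ℕ => urnG T0 σ Λ 0 ^ 2 * (((0 : ℕ) : ℝ) + T0 / σ) / ((n : ℝ) + T0 / σ))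
      (fun n => ?_) ?_
    · rw [le_div_iff₀ (by positivity)]
      exact hanti (Nat.zero_le n)
    · exact tendsto_const_nhds.div_atTop
        (tendsto_natCast_atTop_atTop.atTop_add tendsto_const_nhds)
  have := hsq.sqrt
  simpa [Real.sqrt_sq (urnG_pos hT0 hσ hΛ0 _).le] using this

theorem exists_le_mul_of_urn_recursion {T0 : ℕ} {σ : ℤ} {Λ K : ℝ} (hT0 : 1 ≤ T0) (hσ : 1 ≤ σ)
    (hΛ : 0 < Λ) (hΛ1 : Λ < 1) (hK : 0 ≤ K) {N₀ : ℕ} (hN₀ : 1 ≤ N₀) {P : ℕ → ℤ → ℝ}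
    (hP : ∀ n z, P n z ≤ 1)
    (hrec : ∀ n, N₀ ≤ n → ∀ M, 0 ≤ M → (∀ z, P n z ≤ M) → ∀ z, P (n + 1) z ≤
      M * (1 - Λ / ((n : ℝ) + T0 / σ) + K / (σ * ((n : ℝ) + T0 / σ)) ^ 2)) :
    ∃ C : ℝ, 0 ≤ C ∧ ∀ n, N₀ ≤ n → ∀ z, P n z ≤ C * urnG T0 σ Λ n := by
  have hτ : (0 : ℝ) < T0 / σ := div_pos (by exact_mod_cast hT0) (by exact_mod_cast hσ)
  have hg := urnG_pos hT0 hσ hΛ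
  set D : ℕ → ℝ := fun n => ∑ i ∈ Finset.range n, 2 * K / (i : ℝ) ^ 2 with hD
  have hstep : ∀ n, N₀ ≤ n → ∀ z,
      P n z ≤ (urnG T0 σ Λ N₀)⁻¹ * Real.exp (D n) * urnG T0 σ Λ n := by
    intro n hn
    induction n, hn using Nat.le_induction with
    | base =>
      intro z
      have h1 : 1 ≤ Real.exp (D N₀) := Real.one_le_exp (Finset.sum_nonneg fun i _ => by positivity)
      have h2 : (urnG T0 σ Λ N₀)⁻¹ * Real.exp (D N₀) * urnG T0 σ Λ N₀ = Real.exp (D N₀) := by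
        field_simp [(hg N₀).ne']
      rw [h2]
      exact (hP _ _).trans h1
    | succ n hn ih =>
      intro z
      have hn0 : 0 < urnG T0 σ Λ n := hg n
      have hN0 : 0 < urnG T0 σ Λ N₀ := hg N₀
      refine (hrec n hn _ (by positivity) ih z).trans ?_
      rw [urnG_succ hT0 hσ hΛ]
      have hDs : D (n + 1) = D n + 2 * K / (n : ℝ) ^ 2 := Finset.sum_range_succ _ _
      rw [hDs, Real.exp_add]
      set N : ℝ := (n : ℝ) + T0 / σ with hN
      have hn1 : (1 : ℝ) ≤ n := by exact_mod_cast hN₀.trans hn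
      have hNn : (n : ℝ) ≤ N := by linarith
      have hNpos : 0 < N := by linarith
      have hσ1 : (1 : ℝ) ≤ σ := by exact_mod_cast hσ
      have hr : N / (N + Λ) = 1 - Λ / (N + Λ) := by field_simp; ring
      have hr2 : 1 / 2 ≤ N / (N + Λ) := by
        rw [div_le_div_iff₀ (by norm_num) (by positivity)]; linarith
      have h1 : Λ / (N + Λ) ≤ Λ / N := by gcongr; linarith
      have h2 : K / (σ * N) ^ 2 ≤ K / (n : ℝ) ^ 2 := by
        gcongr
        nlinarith
      have h3 : K / (n : ℝ) ^ 2 ≤ N / (N + Λ) * (2 * K / (n : ℝ) ^ 2) := by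
        have : 0 ≤ K / (n : ℝ) ^ 2 := by positivity
        rw [mul_div_assoc]
        nlinarith
      have h4 : 2 * K / (n : ℝ) ^ 2 + 1 ≤ Real.exp (2 * K / (n : ℝ) ^ 2) := Real.add_one_le_exp _
      have h5 : 1 - Λ / N + K / (σ * N) ^ 2 ≤ N / (N + Λ) * Real.exp (2 * K / (n : ℝ) ^ 2) := by
        have : N / (N + Λ) * (2 * K / (n : ℝ) ^ 2 + 1) ≤
            N / (N + Λ) * Real.exp (2 * K / (n : ℝ) ^ 2) := by gcongr
        linarith
      calc _ ≤ (urnG T0 σ Λ N₀)⁻¹ * Real.exp (D n) * urnG T0 σ Λ n *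
            (N / (N + Λ) * Real.exp (2 * K / (n : ℝ) ^ 2)) := by gcongr
        _ = _ := by ring
  have hsum : Summable fun i : ℕ => 2 * K / (i : ℝ) ^ 2 := by
    simpa [div_eq_mul_inv] using
      (Real.summable_nat_pow_inv.2 (show 1 < 2 by norm_num)).mul_left (2 * K)
  have hN0 : 0 < urnG T0 σ Λ N₀ := hg N₀
  refine ⟨(urnG T0 σ Λ N₀)⁻¹ * Real.exp (∑' i : ℕ, 2 * K / (i : ℝ) ^ 2), by positivity,
    fun n hn z => (hstep n hn z).trans ?_⟩
  have hn0 : 0 < urnG T0 σ Λ n := hg n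
  have hDle : D n ≤ ∑' i : ℕ, 2 * K / (i : ℝ) ^ 2 :=
    hsum.sum_le_tsum _ fun i _ => by positivity
  gcongr

theorem measureReal_Ioo_le_of_forall_le {Ω : Type*} [MeasurableSpace Ω] (μ : Measure Ω)
    [IsProbabilityMeasure μ] (X : Ω → ℕ) {M u v : ℝ}
    (hM : ∀ z : ℤ, μ.real {ω | (X ω : ℤ) = z} ≤ M) (hM0 : 0 ≤ M) (huv : u < v) :
    μ.real {ω | (X ω : ℝ) ∈ Ioo u v} ≤ (v - u + 1) * M := by
  have hsub : {ω | (X ω : ℝ) ∈ Ioo u v} ⊆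
      ⋃ z ∈ Finset.Ioo ⌊u⌋ ⌈v⌉, {ω | (X ω : ℤ) = z} := by
    intro ω hω
    simp only [mem_iUnion, Finset.mem_Ioo, mem_ofPred_eq, exists_prop, exists_eq_right']
    exact ⟨Int.floor_lt.2 (by exact_mod_cast hω.1), Int.lt_ceil.2 (by exact_mod_cast hω.2)⟩
  calc μ.real {ω | (X ω : ℝ) ∈ Ioo u v}
      ≤ μ.real (⋃ z ∈ Finset.Ioo ⌊u⌋ ⌈v⌉, {ω | (X ω : ℤ) = z}) :=
          measureReal_mono hsub (measure_ne_top _ _)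
    _ ≤ ∑ z ∈ Finset.Ioo ⌊u⌋ ⌈v⌉, μ.real {ω | (X ω : ℤ) = z} :=
        measureReal_biUnion_finset_le _ _
    _ ≤ ∑ _z ∈ Finset.Ioo ⌊u⌋ ⌈v⌉, M := Finset.sum_le_sum fun z _ => hM z
    _ = ((⌈v⌉ - ⌊u⌋ - 1).toNat : ℝ) * M := by
        rw [Finset.sum_const, Int.card_Ioo, nsmul_eq_mul]
    _ ≤ (v - u + 1) * M := by
        refine mul_le_mul_of_nonneg_right ?_ hM0
        have h1 := Int.ceil_lt_add_one v
        have h2 := Int.lt_floor_add_one u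
        rw [← Int.cast_natCast (R := ℝ), Int.toNat_eq_max, Int.cast_max]
        refine max_le ?_ ?_
        · push_cast; linarith
        · push_cast; linarith

namespace UrnScheme

variable {Ω : Type*} [m0 : MeasurableSpace Ω] {μ : Measure Ω} {mdlM : Bool} {m : ℕ}
  {a b : ℕ → ℤ} {σ : ℤ} {W0 B0 : ℕ} {W B R : ℕ → Ω → ℕ} {F : Filtration ℕ m0}

theorem apply_sub (hurn : UrnScheme μ mdlM m a b σ W0 B0 W B R F) {r : ℕ} (hr : r ≤ m) :
    a (m - r) = r * (a (m - 1) - a m) + a m := by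
  rw [hurn.affine (m - r) (Nat.sub_le _ _), Nat.cast_sub hr]
  ring

theorem apply_zero (hurn : UrnScheme μ mdlM m a b σ W0 B0 W B R F) :
    b 0 = σ - m * (a (m - 1) - a m) - a m := by
  have h1 := hurn.apply_sub le_rfl
  have h2 := hurn.balanced 0 (Nat.zero_le _)
  rw [Nat.sub_self] at h1
  linarith

theorem total (hurn : UrnScheme μ mdlM m a b σ W0 B0 W B R F) (n : ℕ) (ω : Ω) :
    (W n ω : ℤ) + B n ω = W0 + B0 + σ * n := by
  induction n with
  | zero => simp [hurn.initW, hurn.initB]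
  | succ n ih =>
    rw [hurn.dynW, hurn.dynB]
    have := hurn.balanced (m - R (n + 1) ω) (Nat.sub_le _ _)
    push_cast
    linarith

theorem white_succ (hurn : UrnScheme μ mdlM m a b σ W0 B0 W B R F) (n : ℕ) (ω : Ω) :
    (W (n + 1) ω : ℤ) = W n ω + R (n + 1) ω * (a (m - 1) - a m) + a m := by
  rw [hurn.dynW, hurn.apply_sub (hurn.sampleLe n ω)]
  ring

theorem mul_le_white (hurn : UrnScheme μ mdlM m a b σ W0 B0 W B R F)
    (hh : 0 ≤ a (m - 1) - a m) (n : ℕ) (ω : Ω) : n * a m ≤ (W n ω : ℤ) := by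
  induction n with
  | zero => simp
  | succ n ih =>
    rw [hurn.white_succ]
    have : 0 ≤ (R (n + 1) ω : ℤ) * (a (m - 1) - a m) := by positivity
    push_cast
    linarith

theorem mul_le_black (hurn : UrnScheme μ mdlM m a b σ W0 B0 W B R F)
    (hh : 0 ≤ a (m - 1) - a m) (n : ℕ) (ω : Ω) : n * b 0 ≤ (B n ω : ℤ) := by
  induction n with
  | zero => simp
  | succ n ih =>
    rw [hurn.dynB]
    have h1 := hurn.balanced (m - R (n + 1) ω) (Nat.sub_le _ _)
    rw [hurn.apply_sub (hurn.sampleLe n ω)] at h1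
    have h2 : (R (n + 1) ω : ℤ) * (a (m - 1) - a m) ≤ m * (a (m - 1) - a m) :=
      mul_le_mul_of_nonneg_right (by exact_mod_cast hurn.sampleLe n ω) hh
    have h3 := hurn.apply_zero
    push_cast
    linarith

theorem measureReal_sample_inter [IsProbabilityMeasure μ]
    (hurn : UrnScheme μ mdlM m a b σ W0 B0 W B R F) (n : ℕ) {k : ℕ} (hk : k ≤ m) (z : ℤ) :
    μ.real ({ω | R (n + 1) ω = k} ∩ {ω | (W n ω : ℤ) = z}) =
      samplePoly mdlM m k ((W0 : ℝ) + B0 + σ * n) z * μ.real {ω | (W n ω : ℤ) = z} := by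
  have hF : F n ≤ m0 := F.le n
  have hs : MeasurableSet[F n] {ω | (W n ω : ℤ) = z} :=
    hurn.measW n (MeasurableSet.of_discrete (s := {w : ℕ | (w : ℤ) = z}))
  have hR : MeasurableSet {ω | R (n + 1) ω = k} :=
    F.le (n + 1) _ (hurn.measR n (measurableSet_singleton k))
  have hint : Integrable ({ω | R (n + 1) ω = k}.indicator fun _ => (1 : ℝ)) μ :=
    (integrable_const 1).indicator hR
  have h1 := setIntegral_condExp hF hint hs
  rw [setIntegral_indicator hR, setIntegral_const, smul_eq_mul, mul_one, inter_comm] at h1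
  rw [← h1, setIntegral_congr_ae (g := fun _ => samplePoly mdlM m k ((W0 : ℝ) + B0 + σ * n) z)
    (hF _ hs), setIntegral_const, smul_eq_mul, mul_comm]
  filter_upwards [hurn.condLaw n k hk] with ω hω hz
  have hz' : (W n ω : ℝ) = z := by exact_mod_cast (congrArg (Int.cast (R := ℝ)) hz)
  have hT : (W n ω : ℝ) + B n ω = W0 + B0 + σ * n := by exact_mod_cast hurn.total n ω
  have hfit := hurn.sampleFit n ω
  rw [hω, ← hz', ← hT]
  cases mdlM
  · simpa using sampleProbR_eq_samplePoly hk (by simpa using hfit)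
  · simpa using sampleProbM_eq_samplePoly hk (by simpa using hfit)

theorem measureReal_white_succ_le [IsProbabilityMeasure μ]
    (hurn : UrnScheme μ mdlM m a b σ W0 B0 W B R F) (n : ℕ) (z : ℤ) :
    μ.real {ω | (W (n + 1) ω : ℤ) = z} ≤ ∑ k ∈ Finset.range (m + 1),
      samplePoly mdlM m k ((W0 : ℝ) + B0 + σ * n) ((z - a m - (a (m - 1) - a m) * k : ℤ) : ℝ) *
        μ.real {ω | (W n ω : ℤ) = z - a m - (a (m - 1) - a m) * k} := by
  have hsub : {ω | (W (n + 1) ω : ℤ) = z} ⊆ ⋃ k ∈ Finset.range (m + 1),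
      ({ω | R (n + 1) ω = k} ∩ {ω | (W n ω : ℤ) = z - a m - (a (m - 1) - a m) * k}) := by
    intro ω hω
    simp only [mem_iUnion]
    refine ⟨R (n + 1) ω, Finset.mem_range.2 (Nat.lt_succ_iff.2 (hurn.sampleLe n ω)), rfl, ?_⟩
    have h1 := hurn.white_succ n ω
    rw [mem_ofPred_eq] at hω ⊢
    linarith
  refine (measureReal_mono hsub (measure_ne_top _ _)).trans
    ((measureReal_biUnion_finset_le _ _).trans_eq ?_)
  refine Finset.sum_congr rfl fun k hk => ?_
  exact hurn.measureReal_sample_inter n (Nat.lt_succ_iff.1 (Finset.mem_range.1 hk)) _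

theorem measureReal_white_succ_le_mul [IsProbabilityMeasure μ]
    (hurn : UrnScheme μ mdlM m a b σ W0 B0 W B R F) (ham : 1 ≤ a m) (hb0 : 1 ≤ b 0)
    (hh : 0 ≤ a (m - 1) - a m) {n : ℕ} (hn : m * (a (m - 1) - a m) ≤ n) {M : ℝ}
    (hM : ∀ z : ℤ, μ.real {ω | (W n ω : ℤ) = z} ≤ M) (z : ℤ)
    (hz : {ω | (W (n + 1) ω : ℤ) = z}.Nonempty) :
    μ.real {ω | (W (n + 1) ω : ℤ) = z} ≤ M * ∑ k ∈ Finset.range (m + 1),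
      samplePoly mdlM m k ((W0 : ℝ) + B0 + σ * n)
        ((z - a m : ℝ) - (a (m - 1) - a m : ℝ) * k) := by
  refine (hurn.measureReal_white_succ_le n z).trans ?_
  rw [Finset.mul_sum]
  refine Finset.sum_le_sum fun k hk => ?_
  have hk' : k ≤ m := Nat.lt_succ_iff.1 (Finset.mem_range.1 hk)
  obtain ⟨ω, hω⟩ := hz
  rw [mem_ofPred_eq] at hω
  set h : ℤ := a (m - 1) - a m with hh'
  have hkh : h * k ≤ m * h := by
    rw [mul_comm]; exact mul_le_mul_of_nonneg_right (by exact_mod_cast hk') hh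
  have hkh0 : 0 ≤ h * k := by positivity
  have hW := hurn.mul_le_white hh (n + 1) ω
  have hB := hurn.mul_le_black hh (n + 1) ω
  have hT := hurn.total (n + 1) ω
  have hT' := hurn.total n ω
  have hb := hurn.apply_zero
  have hn0 : (0 : ℤ) ≤ n := by positivity
  have hna : (n : ℤ) ≤ n * a m := le_mul_of_one_le_right hn0 ham
  have hnb : (n : ℤ) ≤ n * b 0 := le_mul_of_one_le_right hn0 hb0
  push_cast at hW hB hT
  have hw : 0 ≤ z - a m - h * k := by linarith
  have hbl : 0 ≤ (W0 : ℤ) + B0 + σ * n - (z - a m - h * k) := by linarith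
  obtain ⟨w, hw'⟩ := Int.eq_ofNat_of_zero_le hw
  obtain ⟨c, hc⟩ := Int.eq_ofNat_of_zero_le hbl
  have hsum : (w : ℤ) + c = W0 + B0 + σ * n := by linarith
  have hsumR : (w : ℝ) + c = W0 + B0 + σ * n := by exact_mod_cast hsum
  have hwR : (w : ℝ) = ((z - a m - h * k : ℤ) : ℝ) := by rw [hw']; rfl
  have hfit : (if mdlM then m else 1) ≤ w + c := by
    have h1 := hurn.sampleFit n ω
    have h2 : w + c = W n ω + B n ω := by omega
    rwa [h2]
  have hnn := samplePoly_nonneg hk' hfit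
  rw [hsumR, hwR] at hnn
  have hcast : ((z - a m - h * k : ℤ) : ℝ) = (z - a m : ℝ) - (a (m - 1) - a m : ℝ) * k := by
    rw [hh']; push_cast; ring
  rw [← hcast, mul_comm M]
  exact mul_le_mul_of_nonneg_left (hM _) hnn

/-- Local bound: the atoms of `W n` are of the order of `urnG`. -/
theorem exists_measureReal_white_le [IsProbabilityMeasure μ]
    (hurn : UrnScheme μ mdlM m a b σ W0 B0 W B R F) (ham : 1 ≤ a m) (hb0 : 1 ≤ b 0)
    (hT0 : 1 ≤ W0 + B0) (hΛ : 0 < urnIndex m a σ) (hΛ1 : urnIndex m a σ < 1) :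
    ∃ C : ℝ, 0 ≤ C ∧ ∀ᶠ n in atTop, ∀ z : ℤ,
      μ.real {ω | (W n ω : ℤ) = z} ≤ C * urnG (W0 + B0) σ (urnIndex m a σ) n := by
  have hσ : (1 : ℝ) ≤ σ := by exact_mod_cast hurn.hσ
  have hm : (1 : ℝ) ≤ m := by exact_mod_cast hurn.hm
  have hΛσ : (m : ℝ) * ((a (m - 1) : ℝ) - a m) = urnIndex m a σ * σ := by
    unfold urnIndex
    field_simp
  have hhR : (0 : ℝ) < (a (m - 1) : ℝ) - a m := by
    have : 0 < (m : ℝ) * ((a (m - 1) : ℝ) - a m) := by rw [hΛσ]; positivity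
    exact pos_of_mul_pos_right this (by positivity)
  have hh : 0 < a (m - 1) - a m := by exact_mod_cast hhR
  obtain ⟨K, hK, hsum⟩ := exists_sum_samplePoly_le mdlM m hurn.hm _ hhR
  set N₀ : ℕ := 1 + (m * (a (m - 1) - a m)).toNat + 2 * m with hN₀
  suffices hrec : ∀ n, N₀ ≤ n → ∀ M : ℝ, 0 ≤ M →
      (∀ z : ℤ, μ.real {ω | (W n ω : ℤ) = z} ≤ M) → ∀ z : ℤ,
      μ.real {ω | (W (n + 1) ω : ℤ) = z} ≤
        M * (1 - urnIndex m a σ / ((n : ℝ) + ((W0 + B0 : ℕ) : ℝ) / σ) +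
          K / (σ * ((n : ℝ) + ((W0 + B0 : ℕ) : ℝ) / σ)) ^ 2) by
    obtain ⟨C, hC, hbd⟩ := exists_le_mul_of_urn_recursion hT0 hurn.hσ hΛ hΛ1 hK
      (show 1 ≤ N₀ by omega) (P := fun n z => μ.real {ω | (W n ω : ℤ) = z})
      (fun n z => measureReal_le_one) hrec
    exact ⟨C, hC, eventually_atTop.2 ⟨N₀, hbd⟩⟩
  intro n hn M hM0 hM z
  have hn1 : m * (a (m - 1) - a m) ≤ (n : ℤ) := by omega
  have hn2 : 2 * m ≤ n := by omega
  have hn2R : (2 : ℝ) * m ≤ n := by exact_mod_cast hn2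
  have hTσ : (W0 : ℝ) + B0 + σ * n = σ * ((n : ℝ) + ((W0 + B0 : ℕ) : ℝ) / σ) := by
    push_cast
    field_simp
    ring
  have hTge : 2 * (m : ℝ) ≤ (W0 : ℝ) + B0 + σ * n := by
    have h1 : (n : ℝ) ≤ σ * n := le_mul_of_one_le_left (by positivity) hσ
    have h2 : (0 : ℝ) ≤ (W0 : ℝ) + B0 := by positivity
    linarith
  have hS := hsum _ ((z : ℝ) - a m) hTge
  rw [hΛσ, hTσ, mul_comm (urnIndex m a σ), mul_div_mul_left _ _ (by positivity)] at hS
  by_cases hz : {ω | (W (n + 1) ω : ℤ) = z}.Nonempty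
  · refine (hurn.measureReal_white_succ_le_mul ham hb0 hh.le hn1 hM z hz).trans ?_
    rw [hTσ]
    exact mul_le_mul_of_nonneg_left hS hM0
  · rw [not_nonempty_iff_eq_empty.1 hz, measureReal_empty]
    set N : ℝ := (n : ℝ) + ((W0 + B0 : ℕ) : ℝ) / σ with hN
    have hN1 : 1 ≤ N := by
      have : (0 : ℝ) ≤ ((W0 + B0 : ℕ) : ℝ) / σ := by positivity
      linarith
    have h1 : urnIndex m a σ / N ≤ 1 := by
      rw [div_le_one (by linarith)]
      linarith
    have h2 : 0 ≤ K / (σ * N) ^ 2 := by positivity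
    exact mul_nonneg hM0 (by linarith)

end UrnScheme

/-- The limit `𝒲_∞` of the martingale `𝒲_n = g_n (W_n - E[W_n])` in a
large-index urn has an absolutely continuous law admitting a bounded density on ℝ. -/
theorem largeIndex_density {Ω : Type*} [m0 : MeasurableSpace Ω] (μ : Measure Ω)
    [IsProbabilityMeasure μ] (mdlM : Bool) (m : ℕ) (a b : ℕ → ℤ) (σ : ℤ) (W0 B0 : ℕ)
    (W B : ℕ → Ω → ℕ) (R : ℕ → Ω → ℕ) (F : Filtration ℕ m0)
    (hurn : UrnScheme μ mdlM m a b σ W0 B0 W B R F)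
    (ham : 1 ≤ a m) (hb0 : 1 ≤ b 0)
    (hΛlo : 1 / 2 < urnIndex m a σ) (hΛhi : urnIndex m a σ < 1)
    (Winf : Ω → ℝ) (hmeas : Measurable Winf)
    (hWinf : ∀ᵐ ω ∂μ, Tendsto (fun n : ℕ => calW μ σ (urnIndex m a σ) (W0 + B0) W n ω)
      atTop (𝓝 (Winf ω))) :
    μ.map Winf ≪ volume ∧
    ∃ f : ℝ → ℝ, (∀ x, 0 ≤ f x) ∧ (∃ K : ℝ, ∀ x, f x ≤ K) ∧
      μ.map Winf = volume.withDensity fun x => ENNReal.ofReal (f x) := by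
  obtain ⟨ω₀⟩ : Nonempty Ω := by
    by_contra hne
    rw [not_nonempty_iff] at hne
    exact IsProbabilityMeasure.ne_zero μ (Measure.eq_zero_of_isEmpty μ)
  have hT0 : 1 ≤ W0 + B0 := by
    have h1 := hurn.sampleFit 0 ω₀
    rw [hurn.initW, hurn.initB] at h1
    have h2 := hurn.hm
    split_ifs at h1 <;> omega
  have hΛ0 : 0 < urnIndex m a σ := by linarith
  have hg := urnG_pos hT0 hurn.hσ hΛ0
  obtain ⟨C, hC, hatom⟩ := hurn.exists_measureReal_white_le ham hb0 hT0 hΛ0 hΛhi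
  have hmW : ∀ n, Measurable fun ω => (W n ω : ℝ) := fun n =>
    (measurable_from_top (f := fun k : ℕ => (k : ℝ))).comp ((hurn.measW n).mono (F.le n) le_rfl)
  have hmX : ∀ n, Measurable (calW μ σ (urnIndex m a σ) (W0 + B0) W n) := fun n =>
    ((hmW n).sub_const _).const_mul _
  have hIoo : ∀ x y : ℝ, x < y → μ (Winf ⁻¹' Ioo x y) ≤ ENNReal.ofReal (C * (y - x)) := by
    intro x y hxy
    refine measure_preimage_Ioo_le_of_tendsto_ae μ hmX hWinf
      (d := fun n => C * (y - x) + C * urnG (W0 + B0) σ (urnIndex m a σ) n) ?_ ?_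
    · filter_upwards [hatom] with n hn
      have hgn := hg n
      set g := urnG (W0 + B0) σ (urnIndex m a σ) n with hgdef
      set E := ∫ ω', (W n ω' : ℝ) ∂μ with hE
      have hset : calW μ σ (urnIndex m a σ) (W0 + B0) W n ⁻¹' Ioo x y =
          {ω | (W n ω : ℝ) ∈ Ioo (E + x / g) (E + y / g)} := by
        ext ω
        simp only [mem_preimage, mem_ofPred_eq, mem_Ioo, calW, ← hgdef, ← hE]
        rw [← lt_sub_iff_add_lt', ← sub_lt_iff_lt_add', div_lt_iff₀' hgn, lt_div_iff₀' hgn]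
      rw [hset, ← ofReal_measureReal]
      refine ENNReal.ofReal_le_ofReal ?_
      refine (measureReal_Ioo_le_of_forall_le μ (W n) hn (by positivity)
        (by gcongr)).trans_eq ?_
      field_simp
      ring
    · simpa using ((tendsto_urnG_zero hT0 hurn.hσ hΛlo).const_mul C).const_add (C * (y - x))
  have : IsProbabilityMeasure (μ.map Winf) := Measure.isProbabilityMeasure_map hmeas.aemeasurable
  refine Measure.exists_bounded_density_of_le_smul_volume _ (2 * C).toNNReal
    (Measure.le_smul_volume_of_closedBall_le _ _ fun x r hr => ?_)
  calc μ.map Winf (Metric.closedBall x r)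
      ≤ μ.map Winf (Ioo (x - 2 * r) (x + 2 * r)) := by
        refine measure_mono fun y hy => ?_
        rw [Real.closedBall_eq_Icc] at hy
        exact ⟨by linarith [hy.1], by linarith [hy.2]⟩
    _ = μ (Winf ⁻¹' Ioo (x - 2 * r) (x + 2 * r)) := Measure.map_apply hmeas measurableSet_Ioo
    _ ≤ ENNReal.ofReal (C * ((x + 2 * r) - (x - 2 * r))) := hIoo _ _ (by linarith)
    _ = (2 * C).toNNReal * volume (Metric.closedBall x r) := by
        rw [Real.volume_closedBall, ← ENNReal.ofReal, ← ENNReal.ofReal_mul (by positivity)]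
        congr 1
        ring
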